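/- arXiv:2509.11237 — 2 statements merged into one kernel-verified Lean document; each statement's English description precedes it below -/
import Mathlib

section
/- For every integer t ≥ 4, the element b·a of M_{2^t} has multiplicative order exactly 2^(t-1); hence the cyclic subgroup ⟨b·a⟩ generated by b·a has exactly 2^(t-1) elements, the same cardinality as the cyclic subgroup ⟨a⟩. -/
/-- The multiplier `2^(t-2)+1` squares to `1` modulo `2^(t-1)` when `t ≥ 3`. -/
lemma Mmod.key (t : ℕ) (ht : 3 ≤ t) :
    ((2 ^ (t - 2) + 1 : ZMod (2 ^ (t - 1))) * (2 ^ (t - 2) + 1)) = 1 := by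
  obtain ⟨s, rfl⟩ := Nat.exists_eq_add_of_le ht
  have h2 : 3 + s - 2 = s + 1 := by omega
  have h3 : 3 + s - 1 = s + 2 := by omega
  rw [h2, h3]
  have h0 : ((2 ^ (s + 2) : ℕ) : ZMod (2 ^ (s + 2))) = 0 := ZMod.natCast_self _
  push_cast at h0
  linear_combination ((2 : ZMod (2 ^ (s + 2))) ^ s + 1) * h0

/-- The automorphism of `Multiplicative (ZMod (2^(t-1)))` given by multiplication of the
exponent by `2^(t-2)+1`. -/
def Mmod.uAut (t : ℕ) (ht : 3 ≤ t) :
    MulAut (Multiplicative (ZMod (2 ^ (t - 1)))) where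
  toFun x := Multiplicative.ofAdd ((2 ^ (t - 2) + 1) * x.toAdd)
  invFun x := Multiplicative.ofAdd ((2 ^ (t - 2) + 1) * x.toAdd)
  left_inv x := by
    simp only [toAdd_ofAdd, ← mul_assoc, Mmod.key t ht, one_mul,
      ofAdd_toAdd]
  right_inv x := by
    simp only [toAdd_ofAdd, ← mul_assoc, Mmod.key t ht, one_mul,
      ofAdd_toAdd]
  map_mul' x y := by
    simp only [toAdd_mul, mul_add, ofAdd_add]

lemma Mmod.uAut_sq (t : ℕ) (ht : 3 ≤ t) : (Mmod.uAut t ht) ^ 2 = 1 := by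
  rw [pow_two]
  ext x
  show (Mmod.uAut t ht) ((Mmod.uAut t ht) x) = x
  show Multiplicative.ofAdd ((2 ^ (t - 2) + 1) *
    (Multiplicative.ofAdd ((2 ^ (t - 2) + 1) * x.toAdd)).toAdd) = x
  simp only [toAdd_ofAdd, ← mul_assoc, Mmod.key t ht, one_mul,
    ofAdd_toAdd]

/-- The action of `ZMod 2` on `ZMod (2^(t-1))` by multiplication by `2^(t-2)+1`. -/
def Mmod.phi (t : ℕ) (ht : 3 ≤ t) :
    Multiplicative (ZMod 2) →* MulAut (Multiplicative (ZMod (2 ^ (t - 1)))) where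
  toFun g := (Mmod.uAut t ht) ^ (g.toAdd.val)
  map_one' := by
    show (Mmod.uAut t ht) ^ ((0 : ZMod 2).val) = 1
    simp
  map_mul' := fun g h => by
    show (Mmod.uAut t ht) ^ ((g.toAdd + h.toAdd).val) =
      (Mmod.uAut t ht) ^ (g.toAdd.val) * (Mmod.uAut t ht) ^ (h.toAdd.val)
    rw [ZMod.val_add, ← pow_eq_pow_mod _ (Mmod.uAut_sq t ht), pow_add]

/-- The modular maximal-cyclic group `M_{2^t}`, realized as the semidirect product
`(ZMod 2^(t-1)) ⋊ (ZMod 2)` where the nontrivial element of `ZMod 2` acts by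
multiplication by `2^(t-2)+1`. -/
abbrev Mmod (t : ℕ) (ht : 3 ≤ t) :=
  SemidirectProduct (Multiplicative (ZMod (2 ^ (t - 1)))) (Multiplicative (ZMod 2))
    (Mmod.phi t ht)

/-- The generator `a` of `M_{2^t}`. -/
def Mmod.a (t : ℕ) (ht : 3 ≤ t) : Mmod t ht :=
  SemidirectProduct.inl (Multiplicative.ofAdd (1 : ZMod (2 ^ (t - 1))))

/-- The generator `b` of `M_{2^t}`. -/
def Mmod.b (t : ℕ) (ht : 3 ≤ t) : Mmod t ht :=
  SemidirectProduct.inr (Multiplicative.ofAdd (1 : ZMod 2))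


lemma Mmod.b_mul_a_sq (t : ℕ) (ht : 3 ≤ t) :
    (Mmod.b t ht * Mmod.a t ht) ^ 2 =
      SemidirectProduct.inl (Multiplicative.ofAdd (2 ^ (t - 2) + 2)) := by
  have hright : (Multiplicative.ofAdd (1 : ZMod 2)) * Multiplicative.ofAdd 1 = 1 := by decide
  have hphi : Mmod.phi t ht (Multiplicative.ofAdd (1 : ZMod 2)) = Mmod.uAut t ht := pow_one _
  have hu (x : ZMod (2 ^ (t - 1))) : Mmod.uAut t ht (Multiplicative.ofAdd x) =
      Multiplicative.ofAdd ((2 ^ (t - 2) + 1) * x) := rfl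
  rw [pow_two]
  ext1
  · simp only [Mmod.a, Mmod.b, SemidirectProduct.mul_left, SemidirectProduct.mul_right,
      SemidirectProduct.left_inl, SemidirectProduct.left_inr, SemidirectProduct.right_inl,
      SemidirectProduct.right_inr, one_mul, mul_one, hphi, hu, ← ofAdd_add]
    congr 1
    linear_combination Mmod.key t ht
  · simpa [Mmod.a, Mmod.b] using hright

lemma Mmod.b_mul_a_pow_two_mul (t : ℕ) (ht : 3 ≤ t) (k : ℕ) :
    (Mmod.b t ht * Mmod.a t ht) ^ (2 * k) =
      SemidirectProduct.inl
        (Multiplicative.ofAdd ((k : ZMod (2 ^ (t - 1))) * (2 ^ (t - 2) + 2))) := by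
  rw [pow_mul, Mmod.b_mul_a_sq, ← map_pow, ← ofAdd_nsmul, nsmul_eq_mul]

lemma Mmod.orderOf_a (t : ℕ) (ht : 3 ≤ t) : orderOf (Mmod.a t ht) = 2 ^ (t - 1) := by
  rw [Mmod.a, orderOf_injective _ SemidirectProduct.inl_injective, orderOf_ofAdd_eq_addOrderOf,
    ZMod.addOrderOf_one]

lemma Mmod.orderOf_b_mul_a (t : ℕ) (ht3 : 3 ≤ t) (ht : 4 ≤ t) :
    orderOf (Mmod.b t ht3 * Mmod.a t ht3) = 2 ^ (t - 1) := by
  obtain ⟨s, rfl⟩ := Nat.exists_eq_add_of_le' ht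
  have h0 : (2 : ZMod (2 ^ (s + 3))) ^ (s + 3) = 0 := by
    exact_mod_cast ZMod.natCast_self (2 ^ (s + 3))
  have hne : (2 : ZMod (2 ^ (s + 3))) ^ (s + 2) ≠ 0 := by
    have h : ((2 ^ (s + 2) : ℕ) : ZMod (2 ^ (s + 3))) ≠ 0 := by
      rw [Ne, ZMod.natCast_eq_zero_iff, Nat.pow_dvd_pow_iff_le_right']
      omega
    exact_mod_cast h
  refine orderOf_eq_prime_pow (p := 2) (n := s + 2) ?_ ?_
  · rw [pow_succ' 2 (s + 1), Mmod.b_mul_a_pow_two_mul,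
      ← map_one SemidirectProduct.inl, SemidirectProduct.inl_inj, ofAdd_eq_one]
    intro h
    apply hne
    push_cast at h
    change (2 : ZMod (2 ^ (s + 3))) ^ (s + 1) * (2 ^ (s + 2) + 2) = 0 at h
    linear_combination h - 2 ^ s * h0
  · rw [pow_succ' 2 (s + 2), Mmod.b_mul_a_pow_two_mul,
      ← map_one SemidirectProduct.inl, SemidirectProduct.inl_inj, ofAdd_eq_one]
    push_cast
    change (2 : ZMod (2 ^ (s + 3))) ^ (s + 2) * (2 ^ (s + 2) + 2) = 0
    linear_combination (2 ^ (s + 1) + 1) * h0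

/-- For every integer `t ≥ 4`, the element `b*a` of `M_{2^t}` has multiplicative order
exactly `2^(t-1)`; hence the cyclic subgroup `⟨b*a⟩` has exactly `2^(t-1)` elements, the
same cardinality as the cyclic subgroup `⟨a⟩`. -/
theorem statement8 (t : ℕ) (ht3 : 3 ≤ t) (ht : 4 ≤ t) :
    orderOf (Mmod.b t ht3 * Mmod.a t ht3) = 2 ^ (t - 1) ∧
    Nat.card (Subgroup.zpowers (Mmod.b t ht3 * Mmod.a t ht3)) = 2 ^ (t - 1) ∧
    Nat.card (Subgroup.zpowers (Mmod.b t ht3 * Mmod.a t ht3)) =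
      Nat.card (Subgroup.zpowers (Mmod.a t ht3)) := by
  simp only [Nat.card_zpowers, Mmod.orderOf_b_mul_a t ht3 ht, Mmod.orderOf_a, and_self]
end

section
/- For every integer t ≥ 3, any two elements ω₁, ω₂ of M_{2^t}, and any natural number n, there exists α ∈ {0, 1} such that (ω₁·ω₂)^n = a^{α·2^(t-2)} · ω₁^n · ω₂^n. -/
/-- The exponent of `phi g x` is `x` multiplied by `2^(t-2)+1` as often as `g` prescribes. -/
lemma Mmod.toAdd_phi (t : ℕ) (ht : 3 ≤ t) (g : Multiplicative (ZMod 2))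
    (x : Multiplicative (ZMod (2 ^ (t - 1)))) :
    (Mmod.phi t ht g x).toAdd =
      (1 + (g.toAdd.val : ZMod (2 ^ (t - 1))) * 2 ^ (t - 2)) * x.toAdd := by
  change ((Mmod.uAut t ht ^ g.toAdd.val) x).toAdd = _
  have hg : g.toAdd.val < 2 := ZMod.val_lt g.toAdd
  generalize g.toAdd.val = k at hg ⊢
  interval_cases k
  · simp
  · change (Multiplicative.ofAdd ((2 ^ (t - 2) + 1) * x.toAdd)).toAdd = _
    simp [add_comm]

lemma Mmod.a_pow (t : ℕ) (ht : 3 ≤ t) (k : ℕ) :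
    Mmod.a t ht ^ k = SemidirectProduct.inl (Multiplicative.ofAdd (k : ZMod (2 ^ (t - 1)))) := by
  rw [Mmod.a, ← map_pow, ← ofAdd_nsmul, nsmul_one]

lemma Mmod.commutator_le_zpowers (t : ℕ) (ht : 3 ≤ t) :
    commutator (Mmod t ht) ≤ Subgroup.zpowers (Mmod.a t ht ^ 2 ^ (t - 2)) := by
  rw [commutator_def, Subgroup.commutator_le]
  intro x _ y _
  let m : ZMod (2 ^ (t - 1)) :=
    x.right.toAdd.val * y.left.toAdd - y.right.toAdd.val * x.left.toAdd
  have hm : (m.val : ZMod (2 ^ (t - 1))) = m := ZMod.natCast_zmod_val m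
  suffices h : x * y * x⁻¹ * y⁻¹ = (Mmod.a t ht ^ 2 ^ (t - 2)) ^ m.val by
    rw [commutatorElement_def, h]
    exact Subgroup.npow_mem_zpowers _ _
  rw [mul_inv_eq_iff_eq_mul, mul_inv_eq_iff_eq_mul, ← pow_mul,
    Mmod.a_pow, mul_assoc]
  refine SemidirectProduct.ext (Multiplicative.toAdd.injective ?_) ?_
  · simp only [SemidirectProduct.mul_left, SemidirectProduct.left_inl,
      SemidirectProduct.right_inl, map_one, MulAut.one_apply, toAdd_mul, toAdd_ofAdd,
      Mmod.toAdd_phi, Nat.cast_mul, hm, Nat.cast_pow, Nat.cast_ofNat, m]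
    ring
  · simp [mul_comm]

/-- For every integer `t ≥ 3`, any two elements `ω₁, ω₂` of `M_{2^t}` and any natural
number `n`, there exists `α ∈ {0, 1}` such that
`(ω₁*ω₂)^n = a^(α*2^(t-2)) * ω₁^n * ω₂^n`. -/
theorem statement12 (t : ℕ) (ht : 3 ≤ t) (ω₁ ω₂ : Mmod t ht) (n : ℕ) :
    ∃ α ∈ ({0, 1} : Set ℕ),
      (ω₁ * ω₂) ^ n = Mmod.a t ht ^ (α * 2 ^ (t - 2)) * ω₁ ^ n * ω₂ ^ n := by
  set c := Mmod.a t ht ^ 2 ^ (t - 2) with hc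
  have hc2 : c ^ 2 = 1 := by
    rw [hc, ← pow_mul, ← pow_succ, show t - 2 + 1 = t - 1 by omega, Mmod.a_pow,
      ZMod.natCast_self, ofAdd_zero, map_one]
  have hmem : (ω₁ * ω₂) ^ n * (ω₁ ^ n * ω₂ ^ n)⁻¹ ∈ Subgroup.zpowers c := by
    apply Mmod.commutator_le_zpowers t ht
    rw [← Abelianization.ker_of, MonoidHom.mem_ker]
    simp [mul_pow]
  obtain ⟨k, hk⟩ := Subgroup.mem_zpowers_iff.mp hmem
  rw [eq_mul_inv_iff_mul_eq, ← mul_assoc] at hk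
  have hc2' : c ^ (2 : ℤ) = 1 := mod_cast hc2
  rcases Int.even_or_odd' k with ⟨j, rfl | rfl⟩
  · refine ⟨0, by simp, ?_⟩
    rw [← hk, zpow_mul, hc2', one_zpow, zero_mul, pow_zero]
  · refine ⟨1, by simp, ?_⟩
    rw [← hk, zpow_add, zpow_mul, hc2', one_zpow, zpow_one, one_mul, one_mul]
end
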